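/- Let M ≥ 1, u₁, u₂ ∈ ℝ³, u_th,1, u_th,2 > 0, and let f(v) = Σ_{|α| ≤ M} f_{1,α} 𝓗_{u_th,1,α}(ξ₁) with ξ₁ = (v − u₁)/√u_th,1. Set w = (u₁ − u₂)/√u_th,2, û = √(u_th,1/u_th,2), R(τ) = (û − 1)/((û − 1)τ + 1) and S(τ) = 1/((û − 1)τ + 1) for τ ∈ [0,1] (the denominator (û−1)τ+1 is positive since û > 0). Suppose the coefficients F_α : [0,1] → ℝ, for |α| ≤ M (with F_α := 0 when some component of α is negative), solve the ODE system dF_α/dτ = Σ_{d=1}^{3} S(τ)² [ u_th,1 R(τ) F_{α−2e_d}(τ) + w_d √u_th,1 F_{α−e_d}(τ) ], with initial condition F_α(0) = f_{1,α}. Define g(v) = Σ_{|α| ≤ M} F_α(1) 𝓗_{u_th,2,α}(ξ₂), where ξ₂ = (v − u₂)/√u_th,2. Then ∫_{ℝ³} p(v) f(v) dv = ∫_{ℝ³} p(v) g(v) dv for every polynomial p : ℝ³ → ℝ of total degree at most M. -/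

import Mathlib

open MeasureTheory Real

/-- Probabilists' Hermite polynomial `He_n(x) = (-1)^n e^{x²/2} dⁿ/dxⁿ e^{-x²/2}`,
extended by `0` for negative indices. -/
noncomputable def He (n : ℤ) (x : ℝ) : ℝ :=
  if n < 0 then 0
  else (-1 : ℝ) ^ n.toNat * Real.exp (x ^ 2 / 2) *
    iteratedDeriv n.toNat (fun y => Real.exp (-(y ^ 2) / 2)) x

/-- Hermite basis function `𝓗_{uth,α}(ξ)`; it vanishes whenever a component of
the multi-index `α` is negative. -/
noncomputable def hermiteH (uth : ℝ) (α : Fin 3 → ℤ) (ξ : Fin 3 → ℝ) : ℝ :=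
  ∏ d : Fin 3, (Real.sqrt (2 * π))⁻¹ * uth ^ ((-(α d : ℝ) - 1) / 2) *
    He (α d) (ξ d) * Real.exp (-(ξ d) ^ 2 / 2)

/-- The set of multi-indices `α ∈ ℕ³` with `|α| ≤ M`. -/
def multiIndices (M : ℕ) : Finset (Fin 3 → ℕ) :=
  (Finset.Icc 0 fun _ => M).filter fun α => ∑ d, α d ≤ M

open Polynomial

/-- The moment `∫ v ^ b * 𝓗_{θ,a}((v - u) / √θ) dv` of a one-dimensional Hermite basis function,
given by its recursion in `b`. -/
noncomputable def hermiteMoment (u θ : ℝ) : ℕ → ℕ → ℝ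
  | a, 0 => if a = 0 then 1 else 0
  | a, b + 1 => u * hermiteMoment u θ a b + θ * hermiteMoment u θ (a + 1) b
      + a * hermiteMoment u θ (a - 1) b

theorem hermiteMoment_eq_zero (u θ : ℝ) {a b : ℕ} (h : b < a) : hermiteMoment u θ a b = 0 := by
  induction b generalizing a with
  | zero => simp [hermiteMoment, h.ne']
  | succ b ih =>
    rw [hermiteMoment, ih (by omega), ih (by omega), ih (by omega)]
    simp

theorem hasDerivAt_hermiteMoment {u θ : ℝ → ℝ} {u' θ' t : ℝ} (hu : HasDerivAt u u' t)
    (hθ : HasDerivAt θ θ' t) (a b : ℕ) :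
    HasDerivAt (fun τ => hermiteMoment (u τ) (θ τ) a b)
      (u' * hermiteMoment (u t) (θ t) (a + 1) b
        + θ' / 2 * hermiteMoment (u t) (θ t) (a + 2) b) t := by
  induction b generalizing a with
  | zero => simpa [hermiteMoment] using hasDerivAt_const t _
  | succ b ih =>
    simp only [hermiteMoment]
    refine (((hu.mul (ih a)).add (hθ.mul (ih (a + 1)))).add
      ((ih (a - 1)).const_mul (a : ℝ))).congr_deriv ?_
    rcases a with _ | a
    · simp
      ring
    · simp
      ring

theorem Polynomial.derivative_hermite_succ (n : ℕ) :
    derivative (hermite (n + 1)) = (n + 1 : ℤ[X]) * hermite n := by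
  induction n with
  | zero => simp
  | succ n ih =>
    rw [hermite_succ (n + 1)]
    simp only [derivative_sub, derivative_mul, ih, derivative_X, derivative_add, derivative_one,
      derivative_natCast]
    rw [hermite_succ n]
    push_cast
    ring

theorem Polynomial.X_mul_hermite (n : ℕ) :
    X * hermite n = hermite (n + 1) + (n : ℤ[X]) * hermite (n - 1) := by
  rw [hermite_succ]
  rcases n with _ | n
  · simp
  · rw [derivative_hermite_succ]
    simp

theorem integrable_polynomial_mul_gaussian (p : ℝ[X]) :
    Integrable fun x : ℝ => p.eval x * Real.exp (-x ^ 2 / 2) := by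
  induction p using Polynomial.induction_on' with
  | add p q hp hq =>
    simp only [eval_add, add_mul]
    exact hp.add hq
  | monomial n c =>
    have h := integrable_rpow_mul_exp_neg_mul_sq (b := 1 / 2) (by norm_num) (s := n)
      (by linarith [n.cast_nonneg (α := ℝ)])
    refine (h.const_mul c).congr (.of_forall fun x => ?_)
    simp only [Real.rpow_natCast, eval_monomial, mul_assoc]
    ring_nf

theorem He_natCast (n : ℕ) (x : ℝ) : He n x = aeval x (hermite n) := by
  rw [He, if_neg (by omega), hermite_eq_deriv_gaussian, iteratedDeriv_eq_iterate, Real.exp_neg]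
  simp only [Int.toNat_natCast, neg_div]
  field_simp

theorem hasDerivAt_hermite_mul_gaussian (n : ℕ) (x : ℝ) :
    HasDerivAt (fun x : ℝ => aeval x (hermite n) * Real.exp (-x ^ 2 / 2))
      (-(aeval x (hermite (n + 1)) * Real.exp (-x ^ 2 / 2))) x := by
  have h : HasDerivAt (fun x : ℝ => -x ^ 2 / 2) (-x) x :=
    (((hasDerivAt_id x).pow 2).neg.div_const 2).congr_deriv (by simp; ring)
  refine (((hermite n).hasDerivAt_aeval x).mul h.exp).congr_deriv ?_
  simp only [hermite_succ, map_sub, map_mul, aeval_X]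
  ring

theorem integrable_pow_mul_hermite_mul_gaussian (u s : ℝ) (a b : ℕ) :
    Integrable fun x : ℝ => (u + s * x) ^ b * aeval x (hermite a) * Real.exp (-x ^ 2 / 2) := by
  refine (integrable_polynomial_mul_gaussian
    ((C u + C s * X) ^ b * (hermite a).map (Int.castRingHom ℝ))).congr (.of_forall fun x => ?_)
  simp [aeval_def, eval_map]

theorem integral_pow_mul_hermite_mul_gaussian (u s : ℝ) (a b : ℕ) :
    ∫ x : ℝ, (u + s * x) ^ b * aeval x (hermite a) * Real.exp (-x ^ 2 / 2)
      = √(2 * π) * s ^ a * hermiteMoment u (s ^ 2) a b := by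
  have hint := integrable_pow_mul_hermite_mul_gaussian u s
  induction b generalizing a with
  | zero =>
    rcases a with _ | a
    · have h := integral_gaussian (1 / 2)
      simp only [hermiteMoment, pow_zero, hermite_zero, map_one, one_mul, if_true, mul_one]
      rw [show 2 * π = π / (1 / 2) by ring, ← h]
      congr 1 with x
      ring_nf
    · have h := integral_eq_zero_of_hasDerivAt_of_integrable (hasDerivAt_hermite_mul_gaussian a)
        (by simpa using (hint (a + 1) 0).neg) (by simpa using hint a 0)
      rw [integral_neg, neg_eq_zero] at h
      simpa [hermiteMoment] using h
  | succ b ih =>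
    have hx (x : ℝ) : x * aeval x (hermite a)
        = aeval x (hermite (a + 1)) + a * aeval x (hermite (a - 1)) := by
      simpa using congrArg (aeval x) (X_mul_hermite a)
    have hsplit : (fun x : ℝ => (u + s * x) ^ (b + 1) * aeval x (hermite a) *
        Real.exp (-x ^ 2 / 2)) = fun x : ℝ =>
          u * ((u + s * x) ^ b * aeval x (hermite a) * Real.exp (-x ^ 2 / 2))
          + s * ((u + s * x) ^ b * aeval x (hermite (a + 1)) * Real.exp (-x ^ 2 / 2))
          + s * a * ((u + s * x) ^ b * aeval x (hermite (a - 1)) * Real.exp (-x ^ 2 / 2)) := by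
      funext x
      linear_combination s * (u + s * x) ^ b * Real.exp (-x ^ 2 / 2) * hx x
    rw [hsplit, integral_add (by exact ((hint _ b).const_mul _).add ((hint _ b).const_mul _))
      ((hint _ b).const_mul _), integral_add ((hint a b).const_mul _) ((hint _ b).const_mul _)]
    simp only [integral_const_mul, ih, hermiteMoment]
    rcases a with _ | a
    · simp
      ring
    · simp
      ring

/-- One factor of `hermiteH`, as a function of the unscaled velocity. -/
noncomputable def hermiteFactor (u θ : ℝ) (a : ℕ) (v : ℝ) : ℝ :=
  (√(2 * π))⁻¹ * θ ^ ((-(a : ℝ) - 1) / 2) * He a ((v - u) / √θ) *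
    Real.exp (-((v - u) / √θ) ^ 2 / 2)

theorem pow_mul_hermiteFactor {θ : ℝ} (hθ : 0 < θ) (u : ℝ) (a b : ℕ) (v : ℝ) :
    v ^ b * hermiteFactor u θ a v = (√(2 * π))⁻¹ * θ ^ ((-(a : ℝ) - 1) / 2) *
      (fun x : ℝ => (u + √θ * x) ^ b * aeval x (hermite a) * Real.exp (-x ^ 2 / 2))
        ((v - u) / √θ) := by
  have hs : √θ ≠ 0 := (Real.sqrt_pos.2 hθ).ne'
  have hv : u + √θ * ((v - u) / √θ) = v := by
    field_simp
    ring
  simp only [hermiteFactor, He_natCast, hv]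
  ring

theorem integrable_pow_mul_hermiteFactor {θ : ℝ} (hθ : 0 < θ) (u : ℝ) (a b : ℕ) :
    Integrable fun v => v ^ b * hermiteFactor u θ a v := by
  simp only [pow_mul_hermiteFactor hθ]
  exact (((integrable_pow_mul_hermite_mul_gaussian u (√θ) a b).comp_div
    (Real.sqrt_pos.2 hθ).ne').comp_sub_right u).const_mul _

theorem integral_pow_mul_hermiteFactor {θ : ℝ} (hθ : 0 < θ) (u : ℝ) (a b : ℕ) :
    ∫ v, v ^ b * hermiteFactor u θ a v = hermiteMoment u θ a b := by
  simp only [pow_mul_hermiteFactor hθ]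
  rw [integral_const_mul, integral_sub_right_eq_self (fun v => (fun x : ℝ =>
    (u + √θ * x) ^ b * aeval x (hermite a) * Real.exp (-x ^ 2 / 2)) (v / √θ)) u,
    Measure.integral_comp_div
      (fun x : ℝ => (u + √θ * x) ^ b * aeval x (hermite a) * Real.exp (-x ^ 2 / 2)), integral_pow_mul_hermite_mul_gaussian, Real.sq_sqrt hθ.le,
    abs_of_pos (Real.sqrt_pos.2 hθ), smul_eq_mul]
  have hpow : θ ^ ((-(a : ℝ) - 1) / 2) * (√θ * √θ ^ a) = 1 := by
    rw [← pow_succ', Real.sqrt_eq_rpow, ← Real.rpow_natCast, ← Real.rpow_mul hθ.le,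
      ← Real.rpow_add hθ]
    push_cast
    ring_nf
    simp
  have h2 : √(2 * π) ≠ 0 := by positivity
  field_simp
  linear_combination hermiteMoment u θ a b * hpow

theorem hermiteH_eq_prod (θ : ℝ) (u v : Fin 3 → ℝ) (α : Fin 3 → ℕ) :
    hermiteH θ (fun d => (α d : ℤ)) (fun d => (v d - u d) / √θ)
      = ∏ d, hermiteFactor (u d) θ (α d) (v d) := by
  simp [hermiteH, hermiteFactor]

theorem integral_eval_mul_sum_hermiteH {θ : ℝ} (hθ : 0 < θ) (u : Fin 3 → ℝ)
    (I : Finset (Fin 3 → ℕ)) (c : (Fin 3 → ℕ) → ℝ) (p : MvPolynomial (Fin 3) ℝ) :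
    ∫ v : Fin 3 → ℝ, MvPolynomial.eval v p *
        ∑ α ∈ I, c α * hermiteH θ (fun d => (α d : ℤ)) (fun d => (v d - u d) / √θ)
      = ∑ s ∈ p.support, p.coeff s *
          ∑ α ∈ I, c α * ∏ d, hermiteMoment (u d) θ (α d) (s d) := by
  have hexp (v : Fin 3 → ℝ) : MvPolynomial.eval v p *
        ∑ α ∈ I, c α * hermiteH θ (fun d => (α d : ℤ)) (fun d => (v d - u d) / √θ)
      = ∑ s ∈ p.support, ∑ α ∈ I, p.coeff s * c α *
          ∏ d, (v d ^ s d * hermiteFactor (u d) θ (α d) (v d)) := by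
    rw [MvPolynomial.eval_eq', Finset.sum_mul_sum]
    refine Finset.sum_congr rfl fun s _ => Finset.sum_congr rfl fun α _ => ?_
    rw [hermiteH_eq_prod, Finset.prod_mul_distrib]
    ring
  have hint (s : Fin 3 →₀ ℕ) (α : Fin 3 → ℕ) : Integrable fun v : Fin 3 → ℝ =>
      p.coeff s * c α * ∏ d, (v d ^ s d * hermiteFactor (u d) θ (α d) (v d)) :=
    (Integrable.fintype_prod (f := fun d x => x ^ s d * hermiteFactor (u d) θ (α d) x)
      fun d => integrable_pow_mul_hermiteFactor hθ (u d) (α d) (s d)).const_mul _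
  simp only [hexp]
  rw [integral_finsetSum _ fun s _ => integrable_finsetSum _ fun α _ => hint s α]
  refine Finset.sum_congr rfl fun s _ => ?_
  rw [integral_finsetSum _ fun α _ => hint s α, Finset.mul_sum]
  refine Finset.sum_congr rfl fun α _ => ?_
  rw [integral_const_mul, integral_fintype_prod_volume_eq_prod
    fun d x => x ^ s d * hermiteFactor (u d) θ (α d) x]
  simp only [integral_pow_mul_hermiteFactor hθ, mul_assoc]

theorem mem_multiIndices {M : ℕ} {α : Fin 3 → ℕ} : α ∈ multiIndices M ↔ ∑ d, α d ≤ M := by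
  simp only [multiIndices, Finset.mem_filter, Finset.mem_Icc, and_iff_right_iff_imp]
  exact fun h => ⟨fun d => Nat.zero_le _, fun d =>
    (Finset.single_le_sum (fun _ _ => Nat.zero_le _) (Finset.mem_univ d)).trans h⟩

/-- Summation by shifting the multi-index. -/
theorem sum_multiIndices_shift (M k : ℕ) (d : Fin 3) {F : (Fin 3 → ℤ) → ℝ}
    (hF : ∀ α : Fin 3 → ℤ, (∃ d, α d < 0) → F α = 0) {G : (Fin 3 → ℕ) → ℝ}
    (hG : ∀ α, M < ∑ d, α d → G α = 0) :
    ∑ α ∈ multiIndices M, F (fun j => (α j : ℤ) - if j = d then (k : ℤ) else 0) * G α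
      = ∑ α ∈ multiIndices M, F (fun j => (α j : ℤ)) * G (α + Pi.single d k) := by
  have hshift (α : Fin 3 → ℕ) : (fun j => (((α + Pi.single d k : Fin 3 → ℕ) j : ℕ) : ℤ) -
      if j = d then (k : ℤ) else 0) = fun j => (α j : ℤ) := by
    funext j
    by_cases h : j = d <;> simp [h]
  symm
  refine Finset.sum_bij_ne_zero (fun α _ _ => α + Pi.single d k) ?_ ?_ ?_ ?_
  · intro α _ h
    rw [mem_multiIndices]
    by_contra! hlt
    exact h (by rw [hG _ hlt, mul_zero])
  · intro α _ _ β _ _ h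
    exact add_right_cancel h
  · intro β hβ h
    have hle : k ≤ β d := by
      by_contra! hlt
      exact h (by rw [hF _ ⟨d, by simpa using hlt⟩, zero_mul])
    have hsub : β - Pi.single d k + Pi.single d k = β := by
      refine tsub_add_cancel_of_le fun j => ?_
      by_cases hj : j = d
      · subst hj
        simpa using hle
      · simp [hj]
    refine ⟨β - Pi.single d k, ?_, ?_, hsub⟩
    · rw [mem_multiIndices] at hβ ⊢
      exact (Finset.sum_le_sum fun j _ => Nat.sub_le _ _).trans hβ
    · rw [← hshift, hsub]
      exact h
  · intro α _ _
    rw [hshift]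

/-- If the centre and the temperature of the Hermite basis move with velocities `-p` and `-2 q`,
then the moments of order at most `M` of the expansion do not change. -/
theorem hasDerivAt_sum_mul_prod_hermiteMoment {M : ℕ} {F : (Fin 3 → ℤ) → ℝ → ℝ}
    (hneg : ∀ α : Fin 3 → ℤ, (∃ d, α d < 0) → ∀ τ, F α τ = 0)
    {u : Fin 3 → ℝ → ℝ} {θ : ℝ → ℝ} {p : Fin 3 → ℝ} {q τ : ℝ}
    (hu : ∀ d, HasDerivAt (u d) (-p d) τ) (hθ : HasDerivAt θ (-(2 * q)) τ)
    (hF : ∀ α ∈ multiIndices M, HasDerivAt (fun σ => F (fun d => (α d : ℤ)) σ)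
      (∑ d, (q * F (fun j => (α j : ℤ) - if j = d then 2 else 0) τ
        + p d * F (fun j => (α j : ℤ) - if j = d then 1 else 0) τ)) τ)
    {β : Fin 3 → ℕ} (hβ : ∑ d, β d ≤ M) :
    HasDerivAt (fun σ => ∑ α ∈ multiIndices M, F (fun d => (α d : ℤ)) σ *
      ∏ d, hermiteMoment (u d σ) (θ σ) (α d) (β d)) 0 τ := by
  set G : (Fin 3 → ℕ) → ℝ := fun α => ∏ d, hermiteMoment (u d τ) (θ τ) (α d) (β d) with hGdef
  have hG (α : Fin 3 → ℕ) (h : M < ∑ d, α d) : G α = 0 := by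
    obtain ⟨d, -, hd⟩ := Finset.exists_lt_of_sum_lt (hβ.trans_lt h)
    exact Finset.prod_eq_zero (Finset.mem_univ d) (hermiteMoment_eq_zero _ _ hd)
  have hGs (α : Fin 3 → ℕ) (d : Fin 3) (k : ℕ) : G (α + Pi.single d k)
      = (∏ j ∈ Finset.univ.erase d, hermiteMoment (u j τ) (θ τ) (α j) (β j)) *
        hermiteMoment (u d τ) (θ τ) (α d + k) (β d) := by
    simp only [hGdef]
    rw [← Finset.prod_erase_mul _ _ (Finset.mem_univ d)]
    congr 1
    · refine Finset.prod_congr rfl fun j hj => ?_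
      simp [Finset.ne_of_mem_erase hj]
    · simp
  have hprod (α : Fin 3 → ℕ) : HasDerivAt
      (fun σ => ∏ d, hermiteMoment (u d σ) (θ σ) (α d) (β d))
      (∑ d, (-p d * G (α + Pi.single d 1) - q * G (α + Pi.single d 2))) τ := by
    refine (HasDerivAt.fun_finsetProd fun d _ =>
      hasDerivAt_hermiteMoment (hu d) hθ (α d) (β d)).congr_deriv ?_
    refine Finset.sum_congr rfl fun d _ => ?_
    rw [hGs, hGs, smul_eq_mul]
    ring
  refine (HasDerivAt.fun_sum fun α hα => (hF α hα).mul (hprod α)).congr_deriv ?_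
  simp only [Finset.sum_mul, Finset.mul_sum, ← Finset.sum_add_distrib]
  rw [Finset.sum_comm]
  refine Finset.sum_eq_zero fun d _ => ?_
  have h1 := sum_multiIndices_shift M 1 d (fun α h => hneg α h τ) hG
  have h2 := sum_multiIndices_shift M 2 d (fun α h => hneg α h τ) hG
  push_cast at h1 h2
  rw [← sub_eq_zero, ← Finset.sum_sub_distrib] at h1 h2
  rw [show (0 : ℝ) = p d * 0 + q * 0 by ring]
  nth_rewrite 1 [← h1]
  rw [← h2, Finset.mul_sum, Finset.mul_sum, ← Finset.sum_add_distrib]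
  refine Finset.sum_congr rfl fun α _ => ?_
  ring

/-- The projection proposition: if the coefficients `Fc` solve the ODE system
on `[0,1]` with initial data given by the Hermite coefficients of `f` (in the
basis with parameters `u₁, uth₁`), then the function `g` built from `Fc(1)`
in the basis with parameters `u₂, uth₂` has the same moments as `f` up to
total degree `M`. -/
theorem hermite_projection
    (M : ℕ) (hM : 1 ≤ M)
    (u1 u2 : Fin 3 → ℝ) (uth1 uth2 : ℝ) (huth1 : 0 < uth1) (huth2 : 0 < uth2)
    (c : (Fin 3 → ℕ) → ℝ) (f g : (Fin 3 → ℝ) → ℝ)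
    -- `f` is the finite Hermite expansion with coefficients `c α = f_{1,α}`
    (hf : ∀ v, f v = ∑ α ∈ multiIndices M, c α *
      hermiteH uth1 (fun d => (α d : ℤ)) (fun d => (v d - u1 d) / Real.sqrt uth1))
    -- the auxiliary quantities `w`, `uhat`, `R`, `S`
    (w : Fin 3 → ℝ) (uhat : ℝ) (R S : ℝ → ℝ)
    (hw : ∀ d, w d = (u1 d - u2 d) / Real.sqrt uth2)
    (huhat : uhat = Real.sqrt (uth1 / uth2))
    (hR : ∀ τ, R τ = (uhat - 1) / ((uhat - 1) * τ + 1))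
    (hS : ∀ τ, S τ = 1 / ((uhat - 1) * τ + 1))
    -- the coefficients `Fc`, vanishing for negative multi-indices
    (Fc : (Fin 3 → ℤ) → ℝ → ℝ)
    (hFneg : ∀ α : Fin 3 → ℤ, (∃ d, α d < 0) → ∀ τ, Fc α τ = 0)
    -- the ODE system on `[0,1]`
    (hODE : ∀ α ∈ multiIndices M, ∀ τ ∈ Set.Icc (0 : ℝ) 1,
      HasDerivAt (fun σ => Fc (fun d => (α d : ℤ)) σ)
        (∑ d : Fin 3, S τ ^ 2 *
          (uth1 * R τ * Fc (fun j => (α j : ℤ) - if j = d then 2 else 0) τ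
            + w d * Real.sqrt uth1 *
              Fc (fun j => (α j : ℤ) - if j = d then 1 else 0) τ)) τ)
    -- the initial condition `F_α(0) = f_{1,α}`
    (hinit : ∀ α ∈ multiIndices M, Fc (fun d => (α d : ℤ)) 0 = c α)
    -- `g` is built from the coefficients `F_α(1)`
    (hg : ∀ v, g v = ∑ α ∈ multiIndices M, Fc (fun d => (α d : ℤ)) 1 *
      hermiteH uth2 (fun d => (α d : ℤ)) (fun d => (v d - u2 d) / Real.sqrt uth2)) :
    ∀ p : MvPolynomial (Fin 3) ℝ, p.totalDegree ≤ M →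
      (∫ v : Fin 3 → ℝ, MvPolynomial.eval v p * f v)
        = ∫ v : Fin 3 → ℝ, MvPolynomial.eval v p * g v := by
  intro p hp
  simp only [hf, hg]
  rw [integral_eval_mul_sum_hermiteH huth1, integral_eval_mul_sum_hermiteH huth2]
  refine Finset.sum_congr rfl fun s hs => ?_
  congr 1
  have hβ : ∑ d, s d ≤ M := by
    have h := (MvPolynomial.le_totalDegree hs).trans hp
    rwa [Finsupp.sum_fintype _ _ fun _ => rfl] at h
  have hs1 : √uth1 ≠ 0 := (Real.sqrt_pos.2 huth1).ne'
  have hs2 : √uth2 ≠ 0 := (Real.sqrt_pos.2 huth2).ne'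
  have huhat' : uhat = √uth1 / √uth2 := by rw [huhat, Real.sqrt_div huth1.le]
  have hpos : 0 < uhat := by
    rw [huhat]
    positivity
  set den : ℝ → ℝ := fun τ => (uhat - 1) * τ + 1 with hden
  have hden_pos {τ : ℝ} (hτ : τ ∈ Set.Icc (0 : ℝ) 1) : 0 < den τ := by
    rcases hτ with ⟨h0, h1⟩
    rcases h0.eq_or_lt with rfl | h0
    · simp [hden]
    · nlinarith [mul_pos hpos h0]
  have hden_deriv (τ : ℝ) : HasDerivAt den (uhat - 1) τ :=
    (((hasDerivAt_id τ).const_mul (uhat - 1)).add_const 1).congr_deriv (mul_one _)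
  set Φ : ℝ → ℝ := fun τ => ∑ α ∈ multiIndices M, Fc (fun d => (α d : ℤ)) τ *
    ∏ d, hermiteMoment (u1 d - w d * √uth1 * (τ / den τ)) (uth1 / den τ ^ 2) (α d) (s d) with hΦ
  have hΦ' (τ : ℝ) (hτ : τ ∈ Set.Icc (0 : ℝ) 1) : HasDerivAt Φ 0 τ := by
    have hne := (hden_pos hτ).ne'
    have hS' : S τ = 1 / den τ := hS τ
    have hR' : R τ = (uhat - 1) / den τ := hR τ
    refine hasDerivAt_sum_mul_prod_hermiteMoment hFneg
      (u := fun d τ => u1 d - w d * √uth1 * (τ / den τ)) (θ := fun τ => uth1 / den τ ^ 2)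
      (p := fun d => S τ ^ 2 * (w d * √uth1)) (q := S τ ^ 2 * (uth1 * R τ)) ?_ ?_ ?_ hβ
    · intro d
      refine ((((hasDerivAt_id τ).div (hden_deriv τ) hne).const_mul
        (w d * √uth1)).const_sub (u1 d)).congr_deriv ?_
      have hlin : den τ - τ * (uhat - 1) = 1 := by
        simp only [hden]
        ring
      rw [hS', id, one_mul, hlin]
      ring_nf
    · refine ((hasDerivAt_const τ uth1).div ((hden_deriv τ).pow 2)
        (pow_ne_zero 2 hne)).congr_deriv ?_
      rw [hS', hR']
      simp
      field_simp
    · intro α hα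
      refine (hODE α hα τ hτ).congr_deriv (Finset.sum_congr rfl fun d _ => ?_)
      ring
  have hconst : Φ 1 = Φ 0 := constant_of_has_deriv_right_zero
    (fun τ hτ => (hΦ' τ hτ).continuousAt.continuousWithinAt)
    (fun τ hτ => (hΦ' τ (Set.Ico_subset_Icc_self hτ)).hasDerivWithinAt) 1 (by simp)
  have hden_one : den 1 = √uth1 / √uth2 := by simp [hden, huhat']
  have hcentre (d : Fin 3) : u1 d - w d * √uth1 * (1 / den 1) = u2 d := by
    rw [hden_one, hw]
    field_simp
    ring
  have htemp : uth1 / den 1 ^ 2 = uth2 := by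
    rw [hden_one, div_pow, Real.sq_sqrt huth1.le, Real.sq_sqrt huth2.le]
    field_simp
  simp only [hΦ, hcentre, htemp] at hconst
  rw [hconst]
  refine Finset.sum_congr rfl fun α hα => ?_
  simp [hinit α hα, hden]
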